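/- arXiv:2410.04711 — 5 statements merged into one kernel-verified Lean document; each statement's English description precedes it below -/
import Mathlib

section
/- Let N ≥ 1, let U₁ and U₂ be 2^(N-1) × 2^(N-1) unitary matrices over ℂ, and let U = U₁ ⊕ U₂ be the 2^N × 2^N block-diagonal unitary |0⟩⟨0| ⊗ U₁ + |1⟩⟨1| ⊗ U₂. Then U is an element of the N-qubit Pauli group P_N if and only if U₁ is an element of the (N-1)-qubit Pauli group P_{N-1} and U₂ = U₁ or U₂ = -U₁. -/
open Matrix

noncomputable section

/-- `QMat n` : operators on `n` qubits, identified with `2^n × 2^n` complex matrices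
(indexed by bit strings `Fin n → Fin 2`). -/
abbrev QMat (n : ℕ) := Matrix (Fin n → Fin 2) (Fin n → Fin 2) ℂ

/-- The single-qubit Pauli `X` matrix. -/
def σX : Matrix (Fin 2) (Fin 2) ℂ := !![0, 1; 1, 0]

/-- The single-qubit Pauli `Y` matrix. -/
def σY : Matrix (Fin 2) (Fin 2) ℂ := !![0, -Complex.I; Complex.I, 0]

/-- The single-qubit Pauli `Z` matrix. -/
def σZ : Matrix (Fin 2) (Fin 2) ℂ := !![1, 0; 0, -1]

/-- The set `{I, X, Y, Z}` of single-qubit Pauli matrices. -/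
def pauliSet : Set (Matrix (Fin 2) (Fin 2) ℂ) := {1, σX, σY, σZ}

/-- The tensor (Kronecker) product `σ 0 ⊗ ⋯ ⊗ σ (n-1)` of single-qubit matrices. -/
def tensorStr {n : ℕ} (σ : Fin n → Matrix (Fin 2) (Fin 2) ℂ) : QMat n :=
  fun f g => ∏ i, σ i (f i) (g i)

/-- The `n`-qubit Pauli group `P_n`: all `c • (σ₁ ⊗ ⋯ ⊗ σₙ)` with
`σᵢ ∈ {I, X, Y, Z}` and `c ∈ {1, -1, i, -i}`. -/
def PauliGroup (n : ℕ) : Set (QMat n) :=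
  {P | ∃ c ∈ ({1, -1, Complex.I, -Complex.I} : Set ℂ),
    ∃ σ : Fin n → Matrix (Fin 2) (Fin 2) ℂ, (∀ i, σ i ∈ pauliSet) ∧ P = c • tensorStr σ}

/-- Kronecker product `M ⊗ A` of a single-qubit matrix `M` with an `n`-qubit matrix `A`
(the single qubit is the first/topmost factor). -/
def kron {n : ℕ} (M : Matrix (Fin 2) (Fin 2) ℂ) (A : QMat n) : QMat (n + 1) :=
  fun f g => M (f 0) (g 0) * A (fun i => f i.succ) (fun i => g i.succ)

/-- The block-diagonal direct sum `A ⊕ B = |0⟩⟨0| ⊗ A + |1⟩⟨1| ⊗ B`. -/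
def dSum {n : ℕ} (A B : QMat n) : QMat (n + 1) :=
  kron !![1, 0; 0, 0] A + kron !![0, 0; 0, 1] B

/-- The Clifford Hierarchy on `n` qubits: `CH n 1 = P_n`, and for `k ≥ 2`,
`CH n k` consists of the unitaries `U` with `U P U† ∈ CH n (k-1)` for all `P ∈ P_n`.
(The index `0` is unused and set to `∅`.) -/
def CH (n : ℕ) : ℕ → Set (QMat n)
  | 0 => ∅
  | 1 => PauliGroup n
  | (k + 2) => {U | U ∈ unitary (QMat n) ∧ ∀ P ∈ PauliGroup n, U * P * star U ∈ CH n (k + 1)}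

theorem dSum_cons {n : ℕ} (A B : QMat n) (a b : Fin 2) (f g : Fin n → Fin 2) :
    dSum A B (Fin.cons a f) (Fin.cons b g) =
      (!![1, 0; 0, 0] : Matrix (Fin 2) (Fin 2) ℂ) a b * A f g +
      (!![0, 0; 0, 1] : Matrix (Fin 2) (Fin 2) ℂ) a b * B f g := by
  simp [dSum, kron]

theorem tensorStr_cons {n : ℕ} (σ : Fin (n + 1) → Matrix (Fin 2) (Fin 2) ℂ)
    (a b : Fin 2) (f g : Fin n → Fin 2) :
    tensorStr σ (Fin.cons a f) (Fin.cons b g) =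
      σ 0 a b * tensorStr (fun i => σ i.succ) f g := by
  simp [tensorStr, Fin.prod_univ_succ]

theorem dSum_eq_smul {n : ℕ} (A : QMat n) (c s : ℂ)
    (σ : Fin n → Matrix (Fin 2) (Fin 2) ℂ) (M : Matrix (Fin 2) (Fin 2) ℂ)
    (hM : M = !![1, 0; 0, s]) (hA : A = c • tensorStr σ) :
    dSum A (s • A) = c • tensorStr (Fin.cons M σ : Fin (n + 1) → _) := by
  ext f g
  rw [← Fin.cons_self_tail f, ← Fin.cons_self_tail g, dSum_cons, Matrix.smul_apply, Matrix.smul_apply,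
    tensorStr_cons]
  generalize f 0 = a
  generalize g 0 = b
  subst hM hA
  fin_cases a <;> fin_cases b <;> simp <;> ring

/-- For `N ≥ 1` (here `N = n + 1`) and unitary blocks `U₁, U₂` on
`N - 1 = n` qubits, `U₁ ⊕ U₂ ∈ P_N` iff `U₁ ∈ P_{N-1}` and `U₂ = ±U₁`. -/
theorem stmt0 (n : ℕ) (U₁ U₂ : QMat n)
    (h₁ : U₁ ∈ unitary (QMat n)) (h₂ : U₂ ∈ unitary (QMat n)) :
    dSum U₁ U₂ ∈ PauliGroup (n + 1) ↔
      U₁ ∈ PauliGroup n ∧ (U₂ = U₁ ∨ U₂ = -U₁) := by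
  have hne : U₁ ≠ 0 := by
    rintro rfl
    have h := (Unitary.mem_iff.mp h₁).1
    simp at h
  constructor
  · rintro ⟨c, hc, σ, hσ, h⟩
    have e : ∀ a b f g, dSum U₁ U₂ (Fin.cons a f) (Fin.cons b g) =
        c * (σ 0 a b * tensorStr (fun i => σ i.succ) f g) := by
      intro a b f g
      rw [h, Matrix.smul_apply, tensorStr_cons, smul_eq_mul]
    have e0 : ∀ f g, U₁ f g = c * (σ 0 0 0 * tensorStr (fun i => σ i.succ) f g) := by
      intro f g
      rw [← e, dSum_cons]; simp
    have e1 : ∀ f g, U₂ f g = c * (σ 0 1 1 * tensorStr (fun i => σ i.succ) f g) := by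
      intro f g
      rw [← e, dSum_cons]; simp
    have h0 := hσ 0
    simp only [pauliSet, Set.mem_insert_iff, Set.mem_singleton_iff] at h0
    have key : σ 0 0 0 = 1 → U₁ ∈ PauliGroup n := by
      intro h1
      refine ⟨c, hc, fun i => σ i.succ, fun i => hσ _, ?_⟩
      ext f g
      simp [e0, h1]
    rcases h0 with h0 | h0 | h0 | h0
    · refine ⟨key (by simp [h0]), Or.inl ?_⟩
      ext f g
      simp [e0, e1, h0]
    · exact absurd (by ext f g; simp [e0, h0, σX]) hne
    · exact absurd (by ext f g; simp [e0, h0, σY]) hne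
    · refine ⟨key (by simp [h0, σZ]), Or.inr ?_⟩
      ext f g
      simp [e0, e1, h0, σZ]
  · rintro ⟨⟨c, hc, σ, hσ, h⟩, h2⟩
    rcases h2 with h2 | h2
    · refine ⟨c, hc, Fin.cons 1 σ, ?_, ?_⟩
      · intro i
        refine Fin.cases ?_ (fun j => ?_) i
        · simp [pauliSet]
        · simpa using hσ j
      · rw [← dSum_eq_smul U₁ c 1 σ 1 Matrix.one_fin_two h, h2, one_smul]
    · refine ⟨c, hc, Fin.cons σZ σ, ?_, ?_⟩
      · intro i
        refine Fin.cases ?_ (fun j => ?_) i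
        · simp [pauliSet]
        · simpa using hσ j
      · rw [← dSum_eq_smul U₁ c (-1) σ σZ rfl h, h2, neg_one_smul]
end
end

section
/- Let U be a 2^(N-1) × 2^(N-1) unitary matrix and let C(U) = I ⊕ U be the controlled-U gate on N qubits. If C(U) lies in the Clifford Hierarchy on N qubits (i.e., in CH_k for some finite k ≥ 1), then U lies in the Clifford Hierarchy on N-1 qubits (in CH_j for some finite j ≥ 1). -/
open Matrix

noncomputable section

theorem aux_tail_cons {n : ℕ} (a : Fin 2) (f : Fin n → Fin 2) :
    (fun i : Fin n => (Fin.cons a f : Fin (n + 1) → Fin 2) i.succ) = f := by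
  funext i; simp

theorem aux_sum {n : ℕ} (F : (Fin (n + 1) → Fin 2) → ℂ) :
    ∑ f, F f = ∑ f : Fin n → Fin 2, F (Fin.cons 0 f) + ∑ f : Fin n → Fin 2, F (Fin.cons 1 f) := by
  rw [← (Fin.consEquiv (fun _ : Fin (n + 1) => Fin 2)).sum_comp, Fintype.sum_prod_type,
    Fin.sum_univ_two]
  rfl

theorem aux_ext {n : ℕ} {A B : QMat (n + 1)}
    (h : ∀ a b f g, A (Fin.cons a f) (Fin.cons b g) = B (Fin.cons a f) (Fin.cons b g)) :
    A = B := by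
  ext f g
  rw [← Fin.cons_self_tail f, ← Fin.cons_self_tail g]
  exact h _ _ _ _

theorem dSum_mul {n : ℕ} (A B C D : QMat n) :
    dSum A B * dSum C D = dSum (A * C) (B * D) := by
  apply aux_ext
  intro a b f g
  rw [Matrix.mul_apply, aux_sum]
  simp only [dSum_cons, Matrix.mul_apply]
  fin_cases a <;> fin_cases b <;> simp

theorem dSum_star {n : ℕ} (A B : QMat n) : star (dSum A B) = dSum (star A) (star B) := by
  apply aux_ext
  intro a b f g
  simp only [Matrix.star_apply, dSum_cons]
  fin_cases a <;> fin_cases b <;> simp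

theorem dSum_one {n : ℕ} : dSum (1 : QMat n) 1 = 1 := by
  apply aux_ext
  intro a b f g
  simp only [dSum_cons, Matrix.one_apply, Fin.cons_inj]
  fin_cases a <;> fin_cases b <;> simp

theorem dSum_inj {n : ℕ} {A B C D : QMat n} (h : dSum A B = dSum C D) : B = D := by
  ext f g
  have := congrFun (congrFun h (Fin.cons 1 f)) (Fin.cons 1 g)
  simpa [dSum_cons] using this

theorem dSum_pauli {n : ℕ} {P : QMat n} (h : P ∈ PauliGroup n) :
    dSum P P ∈ PauliGroup (n + 1) := by
  obtain ⟨c, hc, σ, hσ, rfl⟩ := h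
  refine ⟨c, hc, Fin.cons 1 σ, ?_, ?_⟩
  · intro i
    refine Fin.cases ?_ (fun i => ?_) i
    · simp [pauliSet]
    · simpa using hσ i
  · apply aux_ext
    intro a b f g
    simp only [dSum_cons, Matrix.smul_apply, tensorStr, Fin.prod_univ_succ, Fin.cons_zero,
      Fin.cons_succ]
    fin_cases a <;> fin_cases b <;> simp

theorem pauli_ne_zero {n : ℕ} {P : QMat n} (h : P ∈ PauliGroup n) : P ≠ 0 := by
  obtain ⟨c, hc, σ, hσ, rfl⟩ := h
  have hc0 : c ≠ 0 := by
    rcases hc with rfl | rfl | rfl | rfl <;> simp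
  have h1 : ∀ i, ∃ a b, σ i a b ≠ 0 := by
    intro i
    rcases hσ i with h | h | h | h <;> rw [h]
    · exact ⟨0, 0, by simp⟩
    · exact ⟨0, 1, by simp [σX]⟩
    · exact ⟨0, 1, by simp [σY]⟩
    · exact ⟨0, 0, by simp [σZ]⟩
  choose f g hfg using h1
  intro h0
  have := congrFun (congrFun h0 f) g
  simp only [Matrix.smul_apply, tensorStr, Matrix.zero_apply, smul_eq_mul, mul_eq_zero, hc0,
    false_or] at this
  exact Finset.prod_ne_zero_iff.mpr (fun i _ => hfg i) this

theorem block_pauli {n : ℕ} {A B : QMat n} (hB : B ≠ 0)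
    (h : dSum A B ∈ PauliGroup (n + 1)) : B ∈ PauliGroup n := by
  obtain ⟨c, hc, σ, hσ, h⟩ := h
  have hent : B = (c * σ 0 1 1) • tensorStr (fun i => σ i.succ) := by
    ext f g
    have := congrFun (congrFun h (Fin.cons 1 f)) (Fin.cons 1 g)
    simp only [dSum_cons, Matrix.smul_apply, tensorStr, Fin.prod_univ_succ, Fin.cons_zero,
      Fin.cons_succ] at this
    simpa [tensorStr, mul_assoc] using this
  rcases hσ 0 with h0 | h0 | h0 | h0
  · exact ⟨c, hc, _, fun i => hσ _, by simpa [h0] using hent⟩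
  · exact absurd (by simpa [h0, σX] using hent) hB
  · exact absurd (by simpa [h0, σY] using hent) hB
  · refine ⟨-c, ?_, _, fun i => hσ i.succ, by simpa [show σ 0 = σZ from h0, σZ] using hent⟩
    rcases hc with rfl | rfl | rfl | rfl <;> simp

theorem block_CH {n : ℕ} (k : ℕ) : ∀ {A B : QMat n}, B ≠ 0 →
    dSum A B ∈ CH (n + 1) (k + 1) → B ∈ CH n (k + 1) := by
  induction k with
  | zero => intro A B hB h; exact block_pauli hB h
  | succ k ih =>
    intro A B hB h
    obtain ⟨hu, hP⟩ := h
    rw [Unitary.mem_iff, dSum_star, dSum_mul, dSum_mul, ← dSum_one] at hu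
    have h1 := dSum_inj hu.1
    have h2 := dSum_inj hu.2
    refine ⟨Unitary.mem_iff.mpr ⟨h1, h2⟩, fun P hp => ?_⟩
    have h3 := hP _ (dSum_pauli hp)
    rw [dSum_star, dSum_mul, dSum_mul] at h3
    refine ih ?_ h3
    intro h0
    apply pauli_ne_zero hp
    calc P = (star B * B) * P * (star B * B) := by rw [h1]; simp
      _ = star B * (B * P * star B) * B := by simp only [Matrix.mul_assoc]
      _ = 0 := by rw [h0]; simp

/-- If the controlled gate `C(U) = I ⊕ U` lies in the Clifford Hierarchy
on `N = n + 1` qubits (in `CH k` for some finite `k ≥ 1`), then `U` lies in the Clifford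
Hierarchy on `n` qubits. -/
theorem stmt3 (n : ℕ) (U : QMat n) (hU : U ∈ unitary (QMat n))
    (h : ∃ k, 1 ≤ k ∧ dSum 1 U ∈ CH (n + 1) k) :
    ∃ j, 1 ≤ j ∧ U ∈ CH n j := by
  obtain ⟨k, hk, h⟩ := h
  obtain ⟨k, rfl⟩ := Nat.exists_eq_add_of_le' hk
  refine ⟨k + 1, hk, block_CH k ?_ h⟩
  rintro rfl
  have := (Unitary.mem_iff.mp hU).1
  simp at this
end
end

section
/- Let U₁ and U₂ be 2^(N-1) × 2^(N-1) unitary matrices. If U₁ ⊕ U₂ lies in the Clifford Hierarchy on N qubits (in CH_k for some finite k ≥ 1), then there exists an integer m > 0 such that (U₁U₂†)^(2^m) = (U₂U₁†)^(2^m) or (U₁U₂†)^(2^m) = -(U₂U₁†)^(2^m), and moreover both (U₁U₂†)^(2^m) and (U₂U₁†)^(2^m) are elements of the (N-1)-qubit Pauli group P_{N-1}. -/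
open Matrix

noncomputable section

/-- Entries of a Kronecker product. -/
lemma kron_cons {n : ℕ} (M : Matrix (Fin 2) (Fin 2) ℂ) (A : QMat n) (a b : Fin 2)
    (f g : Fin n → Fin 2) :
    kron M A (Fin.cons a f : Fin (n + 1) → Fin 2) (Fin.cons b g : Fin (n + 1) → Fin 2)
      = M a b * A f g := by
  simp [kron]

lemma kron_mul {n : ℕ} (M M' : Matrix (Fin 2) (Fin 2) ℂ) (A A' : QMat n) :
    kron M A * kron M' A' = kron (M * M') (A * A') := by
  ext f g
  rw [Matrix.mul_apply]
  rw [← (Fin.consEquiv (fun _ : Fin (n + 1) => Fin 2)).sum_comp, Fintype.sum_prod_type]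
  simp only [kron, Fin.consEquiv, Equiv.coe_fn_mk, Fin.cons_zero, Fin.cons_succ,
    Matrix.mul_apply, Finset.sum_mul_sum]
  refine Finset.sum_congr rfl fun a _ => Finset.sum_congr rfl fun b _ => ?_
  ring

lemma kron_zero {n : ℕ} (A : QMat n) : kron 0 A = 0 := by
  ext f g; simp [kron]

lemma kron_star {n : ℕ} (M : Matrix (Fin 2) (Fin 2) ℂ) (A : QMat n) :
    (kron M A)ᴴ = kron Mᴴ Aᴴ := by
  ext f g
  simp [kron, Matrix.conjTranspose_apply]

/-- Block anti-diagonal matrix. -/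
def aSum {n : ℕ} (A B : QMat n) : QMat (n + 1) :=
  kron !![0, 1; 0, 0] A + kron !![0, 0; 1, 0] B

lemma tensorStr_one (n : ℕ) : tensorStr (fun _ : Fin n => (1 : Matrix (Fin 2) (Fin 2) ℂ)) = 1 := by
  ext f g
  by_cases h : f = g
  · subst h; simp [tensorStr]
  · rw [Matrix.one_apply_ne h]
    obtain ⟨i, hi⟩ := Function.ne_iff.mp h
    exact Finset.prod_eq_zero (Finset.mem_univ i) (Matrix.one_apply_ne hi)

lemma one_mem_pauli (n : ℕ) : (1 : QMat n) ∈ PauliGroup n :=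
  ⟨1, by simp, fun _ => 1, by simp [pauliSet], by rw [tensorStr_one, one_smul]⟩

lemma neg_one_mem_pauli (n : ℕ) : (-1 : QMat n) ∈ PauliGroup n :=
  ⟨-1, by simp, fun _ => 1, by simp [pauliSet], by rw [tensorStr_one, neg_one_smul]⟩

lemma tensorStr_succ {n : ℕ} (σ : Fin (n + 1) → Matrix (Fin 2) (Fin 2) ℂ) :
    tensorStr σ = kron (σ 0) (tensorStr fun i => σ i.succ) := by
  ext f g
  simp [tensorStr, kron, Fin.prod_univ_succ]

lemma X_mem_pauli (n : ℕ) : kron σX (1 : QMat n) ∈ PauliGroup (n + 1) := by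
  refine ⟨1, by simp, Fin.cons σX fun _ => 1, ?_, ?_⟩
  · intro i
    refine Fin.cases ?_ (fun j => ?_) i <;> simp [pauliSet]
  · rw [one_smul, tensorStr_succ]
    simp [tensorStr_one]

lemma pauli_decomp {n : ℕ} {P : QMat (n + 1)} (h : P ∈ PauliGroup (n + 1)) :
    ∃ M ∈ pauliSet, ∃ Q : QMat n, P = kron M Q := by
  obtain ⟨c, -, σ, hσ, rfl⟩ := h
  refine ⟨σ 0, hσ 0, c • tensorStr fun i => σ i.succ, ?_⟩
  rw [tensorStr_succ]
  ext f g
  simp [kron]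
  ring

lemma dSum_eq_kron {n : ℕ} {A B Q : QMat n} {M : Matrix (Fin 2) (Fin 2) ℂ}
    (h : dSum A B = kron M Q) : A = M 0 0 • Q ∧ B = M 1 1 • Q := by
  constructor
  · ext f g
    have := congrFun (congrFun h (Fin.cons 0 f)) (Fin.cons 0 g)
    simpa [dSum, kron_cons] using this
  · ext f g
    have := congrFun (congrFun h (Fin.cons 1 f)) (Fin.cons 1 g)
    simpa [dSum, kron_cons] using this

lemma aSum_eq_kron {n : ℕ} {A B Q : QMat n} {M : Matrix (Fin 2) (Fin 2) ℂ}
    (h : aSum A B = kron M Q) : A = M 0 1 • Q ∧ B = M 1 0 • Q := by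
  constructor
  · ext f g
    have := congrFun (congrFun h (Fin.cons 0 f)) (Fin.cons 1 g)
    simpa [aSum, kron_cons] using this
  · ext f g
    have := congrFun (congrFun h (Fin.cons 1 f)) (Fin.cons 0 g)
    simpa [aSum, kron_cons] using this

lemma star_mat (a b c d : ℂ) :
    (!![a, b; c, d])ᴴ = !![star a, star c; star b, star d] := by
  ext i j
  fin_cases i <;> fin_cases j <;> rfl

lemma zero_mat : (!![0, 0; 0, 0] : Matrix (Fin 2) (Fin 2) ℂ) = 0 := by
  ext i j
  fin_cases i <;> fin_cases j <;> rfl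

lemma conj_X {n : ℕ} (A B : QMat n) :
    dSum A B * kron σX 1 * star (dSum A B) = aSum (A * Bᴴ) (B * Aᴴ) := by
  simp only [dSum, aSum, star_add, kron_star, add_mul, mul_add, kron_mul, σX, star_mat, mul_one,
    Matrix.mul_fin_two, star_zero, star_one, mul_zero, zero_add, add_zero, zero_mat, kron_zero,
    Matrix.star_eq_conjTranspose]
  abel

lemma conj_X' {n : ℕ} (A B : QMat n) (h : Bᴴ = A) :
    aSum A B * kron σX 1 * star (aSum A B) = aSum (A ^ 2) (B ^ 2) := by
  have h' : Aᴴ = B := by rw [← h, Matrix.conjTranspose_conjTranspose]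
  simp only [aSum, star_add, kron_star, add_mul, mul_add, kron_mul, σX, star_mat, mul_one,
    Matrix.mul_fin_two, star_zero, star_one, mul_zero, zero_add, add_zero, zero_mat, kron_zero,
    Matrix.star_eq_conjTranspose, h, h', pow_two]
  abel

lemma aSum_CH {n : ℕ} (k : ℕ) : ∀ A B : QMat n, Bᴴ = A → A * B = 1 →
    aSum A B ∈ CH (n + 1) (k + 1) →
    A ^ 2 ^ (k + 1) = B ^ 2 ^ (k + 1) ∧ (A ^ 2 ^ (k + 1) = 1 ∨ A ^ 2 ^ (k + 1) = -1) := by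
  induction k with
  | zero =>
    intro A B _ hAB h
    obtain ⟨M, hM, Q, hQ⟩ := pauli_decomp h
    obtain ⟨h1, h2⟩ := aSum_eq_kron hQ
    simp only [zero_add, pow_one, pow_two]
    rcases hM with rfl | rfl | rfl | rfl
    · simp [h1] at hAB
    · have : A = B := by rw [h1, h2]; simp [σX]
      subst this
      exact ⟨rfl, Or.inl hAB⟩
    · have : B = -A := by rw [h1, h2]; simp [σY]
      subst this
      refine ⟨by simp, Or.inr ?_⟩
      rw [← hAB]; simp
    · simp [h1, σZ] at hAB
  | succ k ih =>
    intro A B hs hAB h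
    have h' := h.2 _ (X_mem_pauli n)
    rw [conj_X' A B hs] at h'
    have hBA : B * A = 1 := mul_eq_one_comm.mp hAB
    have := ih (A ^ 2) (B ^ 2) (by rw [Matrix.conjTranspose_pow, hs])
      (by rw [pow_two, pow_two, mul_assoc, ← mul_assoc A B B, hAB, one_mul, hAB]) h'
    simpa only [← pow_mul, ← pow_succ'] using this

/-- If `U₁ ⊕ U₂` lies in the Clifford Hierarchy on `N = n + 1` qubits,
then there is an integer `m > 0` with `(U₁U₂†)^(2^m) = ±(U₂U₁†)^(2^m)` and both
`(U₁U₂†)^(2^m)` and `(U₂U₁†)^(2^m)` in the Pauli group `P_{N-1}`. -/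
theorem stmt5 (n : ℕ) (U₁ U₂ : QMat n)
    (h₁ : U₁ ∈ unitary (QMat n)) (h₂ : U₂ ∈ unitary (QMat n))
    (h : ∃ k, 1 ≤ k ∧ dSum U₁ U₂ ∈ CH (n + 1) k) :
    ∃ m : ℕ, 0 < m ∧
      ((U₁ * U₂ᴴ) ^ 2 ^ m = (U₂ * U₁ᴴ) ^ 2 ^ m ∨
        (U₁ * U₂ᴴ) ^ 2 ^ m = -((U₂ * U₁ᴴ) ^ 2 ^ m)) ∧
      (U₁ * U₂ᴴ) ^ 2 ^ m ∈ PauliGroup n ∧ (U₂ * U₁ᴴ) ^ 2 ^ m ∈ PauliGroup n := by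
  have e1 : U₂ᴴ * U₂ = 1 := (Unitary.mem_iff.mp h₂).1
  have e2 : U₁ᴴ * U₁ = 1 := (Unitary.mem_iff.mp h₁).1
  have e3 : U₁ * U₁ᴴ = 1 := (Unitary.mem_iff.mp h₁).2
  have e4 : U₂ * U₂ᴴ = 1 := (Unitary.mem_iff.mp h₂).2
  have key : ∃ m : ℕ, 0 < m ∧ (U₁ * U₂ᴴ) ^ 2 ^ m = (U₂ * U₁ᴴ) ^ 2 ^ m ∧
      ((U₁ * U₂ᴴ) ^ 2 ^ m = 1 ∨ (U₁ * U₂ᴴ) ^ 2 ^ m = -1) := by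
    obtain ⟨k, hk, h⟩ := h
    obtain _ | _ | k := k
    · omega
    · obtain ⟨M, hM, Q, hQ⟩ := pauli_decomp h
      obtain ⟨a1, a2⟩ := dSum_eq_kron hQ
      refine ⟨1, one_pos, ?_⟩
      rcases hM with rfl | rfl | rfl | rfl
      · have : U₁ = U₂ := by rw [a1, a2]; simp
        subst this
        simp [e3]
      · simp [a1, σX] at e3
      · simp [a1, σY] at e3
      · have : U₁ = -U₂ := by rw [a1, a2]; simp [σZ]
        subst this
        simp [e4]
    · have h' := h.2 _ (X_mem_pauli n)
      rw [conj_X] at h'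
      exact ⟨k + 1, Nat.succ_pos k, aSum_CH k _ _ (by simp)
        (by rw [mul_assoc, ← mul_assoc U₂ᴴ, e1, one_mul, e3]) h'⟩
  obtain ⟨m, hm, heq, hv⟩ := key
  refine ⟨m, hm, Or.inl heq, ?_⟩
  rw [← heq, and_self]
  rcases hv with hv | hv <;> rw [hv]
  · exact one_mem_pauli n
  · exact neg_one_mem_pauli n
end
end

section
/- Every odd-order Clifford gate has odd order up to a global phase: for all σ₁ ∈ {I, X, Y, Z} and σ₂, σ₃ ∈ {X, Y, Z} with σ₂ ≠ σ₃, the 2 × 2 unitary V = σ₁ · exp(i(π/4)σ₂) · exp(i(π/4)σ₃) satisfies V^n = c · I for some odd positive integer n and some unit complex number c. -/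
open Matrix

noncomputable section

/-- `exp(i (π/4) σ) = cos(π/4) • I + (i sin(π/4)) • σ`. -/
def pexp (σ : Matrix (Fin 2) (Fin 2) ℂ) : Matrix (Fin 2) (Fin 2) ℂ :=
  (Real.cos (Real.pi / 4) : ℂ) • 1 + (Complex.I * (Real.sin (Real.pi / 4) : ℂ)) • σ


/-- A `2 × 2` matrix whose determinant is the square of its trace cubes to a scalar. -/
theorem cube_of_trace (M : Matrix (Fin 2) (Fin 2) ℂ) (t : ℂ) (ht : M 0 0 + M 1 1 = t)
    (hd : M 0 0 * M 1 1 - M 0 1 * M 1 0 = t ^ 2) (hn : ‖t‖ = 1) :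
    ∃ (m : ℕ) (c : ℂ), Odd m ∧ 0 < m ∧ ‖c‖ = 1 ∧
      M ^ m = c • (1 : Matrix (Fin 2) (Fin 2) ℂ) := by
  refine ⟨3, -t ^ 3, by decide, by norm_num, by simp [hn], ?_⟩
  subst ht
  ext i j
  fin_cases i <;> fin_cases j <;>
    simp [pow_succ, Matrix.mul_apply, Fin.sum_univ_two]
  · linear_combination (-2 * M 0 0 - M 1 1) * hd
  · linear_combination (-M 0 1) * hd
  · linear_combination (-M 1 0) * hd
  · linear_combination (-M 0 0 - 2 * M 1 1) * hd

/-- Pulling the factors `1/√2` out of the two exponentials. -/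
theorem prod_pexp (A B C : Matrix (Fin 2) (Fin 2) ℂ) :
    A * pexp B * pexp C =
      (1 / 2 : ℂ) • (A * (1 + Complex.I • B) * (1 + Complex.I • C)) := by
  have h (D : Matrix (Fin 2) (Fin 2) ℂ) :
      pexp D = ((Real.sqrt 2 / 2 : ℝ) : ℂ) • (1 + Complex.I • D) := by
    rw [pexp, Real.cos_pi_div_four, Real.sin_pi_div_four, smul_add, smul_smul, mul_comm]
  have h2 : ((Real.sqrt 2 / 2 : ℝ) : ℂ) * ((Real.sqrt 2 / 2 : ℝ) : ℂ) = 1 / 2 := by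
    rw [← Complex.ofReal_mul]
    have : Real.sqrt 2 / 2 * (Real.sqrt 2 / 2) = 1 / 2 := by
      nlinarith [Real.mul_self_sqrt (show (0 : ℝ) ≤ 2 by norm_num)]
    rw [this]; norm_num
  rw [h, h, Matrix.mul_smul, Matrix.mul_smul, Matrix.smul_mul, smul_smul, h2]

/-- Every odd-order Clifford gate `σ₁ · exp(i(π/4)σ₂) · exp(i(π/4)σ₃)`
(with `σ₁ ∈ {I, X, Y, Z}`, `σ₂, σ₃ ∈ {X, Y, Z}`, `σ₂ ≠ σ₃`) has odd order up to a global
phase: `V^m = c • I` for some odd positive integer `m` and unit complex number `c`. -/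
theorem stmt13 (σ₁ σ₂ σ₃ : Matrix (Fin 2) (Fin 2) ℂ)
    (h₁ : σ₁ ∈ ({1, σX, σY, σZ} : Set (Matrix (Fin 2) (Fin 2) ℂ)))
    (h₂ : σ₂ ∈ ({σX, σY, σZ} : Set (Matrix (Fin 2) (Fin 2) ℂ)))
    (h₃ : σ₃ ∈ ({σX, σY, σZ} : Set (Matrix (Fin 2) (Fin 2) ℂ)))
    (hne : σ₂ ≠ σ₃) :
    ∃ (m : ℕ) (c : ℂ), Odd m ∧ 0 < m ∧ ‖c‖ = 1 ∧
      (σ₁ * pexp σ₂ * pexp σ₃) ^ m = c • (1 : Matrix (Fin 2) (Fin 2) ℂ) := by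
  have hI : Complex.I ^ 2 = -1 := Complex.I_sq
  rw [prod_pexp]
  simp only [Set.mem_insert_iff, Set.mem_singleton_iff] at h₁ h₂ h₃
  have key : ∀ M : Matrix (Fin 2) (Fin 2) ℂ,
      ((M 0 0 + M 1 1 = 1 ∨ M 0 0 + M 1 1 = -1) ∧ M 0 0 * M 1 1 - M 0 1 * M 1 0 = 1) ∨
      ((M 0 0 + M 1 1 = Complex.I ∨ M 0 0 + M 1 1 = -Complex.I) ∧
        M 0 0 * M 1 1 - M 0 1 * M 1 0 = -1) →
      ∃ (m : ℕ) (c : ℂ), Odd m ∧ 0 < m ∧ ‖c‖ = 1 ∧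
        M ^ m = c • (1 : Matrix (Fin 2) (Fin 2) ℂ) := by
    rintro M (⟨h | h, hd⟩ | ⟨h | h, hd⟩)
    · exact cube_of_trace M _ h (by rw [hd]; norm_num) (by simp)
    · exact cube_of_trace M _ h (by rw [hd]; norm_num) (by simp)
    · exact cube_of_trace M _ h (by rw [hd, hI]) (by simp)
    · exact cube_of_trace M _ h (by rw [hd, neg_sq, hI]) (by simp)
  apply key
  rcases h₁ with rfl | rfl | rfl | rfl <;> rcases h₂ with rfl | rfl | rfl <;>
    rcases h₃ with rfl | rfl | rfl <;>
    first
    | exact absurd rfl hne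
    | (clear hne
       simp only [σX, σY, σZ, Matrix.smul_apply, Matrix.add_apply, Matrix.mul_apply,
         Fin.sum_univ_two, Matrix.one_apply, Matrix.of_apply, Matrix.cons_val_zero,
         Matrix.cons_val_one, Matrix.cons_val', Matrix.cons_val_fin_one, smul_eq_mul,
         Fin.isValue, if_true, one_ne_zero, zero_ne_one, if_false]
       first
       | exact Or.inl ⟨Or.inl (by grind), by grind⟩
       | exact Or.inl ⟨Or.inr (by grind), by grind⟩
       | exact Or.inr ⟨Or.inl (by grind), by grind⟩
       | exact Or.inr ⟨Or.inr (by grind), by grind⟩)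
end
end

section
/- Adding a control to any Hadamard-like gate produces a gate in the third level of the Clifford Hierarchy: for all σ₁, σ₂ ∈ {X, Y, Z} with σ₁ ≠ σ₂, letting V = σ₁ · exp(i(π/4)σ₂), the controlled gate C(V) = I ⊕ V lies in CH₃ on 2 qubits. -/
open Matrix

noncomputable section

/-- Reindex a `2 × 2` matrix as an operator on one qubit. -/
def toQ1 (M : Matrix (Fin 2) (Fin 2) ℂ) : QMat 1 := fun f g => M (f 0) (g 0)


theorem t_mul (M N M' N' : Matrix (Fin 2) (Fin 2) ℂ) :
    kron M (toQ1 N) * kron M' (toQ1 N') = kron (M * M') (toQ1 (N * N')) := by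
  ext f g
  simp only [Matrix.mul_apply, kron, toQ1]
  rw [← (finTwoArrowEquiv (Fin 2)).symm.sum_comp, Fintype.sum_prod_type]
  simp [finTwoArrowEquiv, Fin.sum_univ_two]
  ring

theorem t_add_left (M M' N : Matrix (Fin 2) (Fin 2) ℂ) :
    kron (M + M') (toQ1 N) = kron M (toQ1 N) + kron M' (toQ1 N) := by
  ext f g; simp [kron, toQ1]; ring

theorem t_smul_left (z : ℂ) (M N : Matrix (Fin 2) (Fin 2) ℂ) :
    kron (z • M) (toQ1 N) = z • kron M (toQ1 N) := by
  ext f g; simp [kron, toQ1]; ring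

theorem t_smul_right (z : ℂ) (M N : Matrix (Fin 2) (Fin 2) ℂ) :
    kron M (toQ1 (z • N)) = z • kron M (toQ1 N) := by
  ext f g; simp [kron, toQ1]; ring

theorem t_star (M N : Matrix (Fin 2) (Fin 2) ℂ) :
    star (kron M (toQ1 N)) = kron (star M) (toQ1 (star N)) := by
  ext f g; simp [kron, toQ1, Matrix.star_apply]

theorem t_one : kron (1 : Matrix (Fin 2) (Fin 2) ℂ) (toQ1 1) = (1 : QMat 2) := by
  ext f g
  simp only [kron, toQ1, Matrix.one_apply]
  have : f = g ↔ f 0 = g 0 ∧ f 1 = g 1 := by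
    constructor
    · rintro rfl; simp
    · rintro ⟨h0, h1⟩; ext i; fin_cases i <;> simp_all
  by_cases h0 : f 0 = g 0 <;> by_cases h1 : f 1 = g 1 <;> simp [this, h0, h1]

theorem I_pow_mem (k : ℕ) : Complex.I ^ k ∈ ({1, -1, Complex.I, -Complex.I} : Set ℂ) := by
  induction k with
  | zero => simp
  | succ k ih =>
    rw [pow_succ]
    simp only [Set.mem_insert_iff, Set.mem_singleton_iff] at ih ⊢
    rcases ih with h | h | h | h <;> rw [h] <;> simp

theorem exists_I_pow {z : ℂ} (h : z ∈ ({1, -1, Complex.I, -Complex.I} : Set ℂ)) :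
    ∃ k : ℕ, z = Complex.I ^ k := by
  simp only [Set.mem_insert_iff, Set.mem_singleton_iff] at h
  rcases h with h | h | h | h
  · exact ⟨0, by simp [h]⟩
  · exact ⟨2, by simp [h]⟩
  · exact ⟨1, by simp [h]⟩
  · exact ⟨3, by simp [h, pow_succ]⟩

theorem mem_pauli2 (P : QMat 2) : P ∈ PauliGroup 2 ↔
    ∃ k : ℕ, ∃ p ∈ pauliSet, ∃ q ∈ pauliSet, P = Complex.I ^ k • kron p (toQ1 q) := by
  constructor
  · rintro ⟨z, hz, σ, hσ, rfl⟩
    obtain ⟨k, rfl⟩ := exists_I_pow hz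
    refine ⟨k, σ 0, hσ 0, σ 1, hσ 1, ?_⟩
    congr 1
    ext f g
    simp [tensorStr, kron, toQ1]
  · rintro ⟨k, p, hp, q, hq, rfl⟩
    refine ⟨_, I_pow_mem k, ![p, q], ?_, ?_⟩
    · intro i; fin_cases i <;> simpa
    · congr 1
      ext f g
      simp [tensorStr, kron, toQ1]

/-- the single-qubit Pauli group -/
def G1 : Set (Matrix (Fin 2) (Fin 2) ℂ) :=
  {M | ∃ k : ℕ, ∃ p ∈ pauliSet, M = Complex.I ^ k • p}

theorem XX : σX * σX = 1 := by ext i j; fin_cases i <;> fin_cases j <;> simp [σX]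
theorem YY : σY * σY = 1 := by ext i j; fin_cases i <;> fin_cases j <;> simp [σY]
theorem ZZ : σZ * σZ = 1 := by ext i j; fin_cases i <;> fin_cases j <;> simp [σZ]
theorem XY : σX * σY = Complex.I • σZ := by
  ext i j; fin_cases i <;> fin_cases j <;> simp [σX, σY, σZ]
theorem YX : σY * σX = -Complex.I • σZ := by
  ext i j; fin_cases i <;> fin_cases j <;> simp [σX, σY, σZ]
theorem YZ : σY * σZ = Complex.I • σX := by
  ext i j; fin_cases i <;> fin_cases j <;> simp [σX, σY, σZ]
theorem ZY : σZ * σY = -Complex.I • σX := by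
  ext i j; fin_cases i <;> fin_cases j <;> simp [σX, σY, σZ]
theorem ZX : σZ * σX = Complex.I • σY := by
  ext i j; fin_cases i <;> fin_cases j <;> simp [σX, σY, σZ]
theorem XZ : σX * σZ = -Complex.I • σY := by
  ext i j; fin_cases i <;> fin_cases j <;> simp [σX, σY, σZ]
theorem starX : star σX = σX := by
  ext i j; fin_cases i <;> fin_cases j <;> simp [σX, Matrix.star_apply]
theorem starY : star σY = σY := by
  ext i j; fin_cases i <;> fin_cases j <;> simp [σY, Matrix.star_apply]
theorem starZ : star σZ = σZ := by
  ext i j; fin_cases i <;> fin_cases j <;> simp [σZ, Matrix.star_apply]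

theorem pauli_G1 {p} (h : p ∈ pauliSet) : p ∈ G1 := ⟨0, p, h, by simp⟩

theorem G1_smul {M} (h : M ∈ G1) : Complex.I • M ∈ G1 := by
  obtain ⟨k, p, hp, rfl⟩ := h
  exact ⟨k + 1, p, hp, by rw [smul_smul, pow_succ']⟩

theorem G1_pow {M} (h : M ∈ G1) (k : ℕ) : Complex.I ^ k • M ∈ G1 := by
  induction k with
  | zero => simpa
  | succ k ih => rw [pow_succ', mul_smul]; exact G1_smul ih

theorem G1_neg {M} (h : M ∈ G1) : -M ∈ G1 := by
  have := G1_pow h 2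
  simpa using this

theorem G1_X : σX ∈ G1 := pauli_G1 (by simp [pauliSet])
theorem G1_Y : σY ∈ G1 := pauli_G1 (by simp [pauliSet])
theorem G1_Z : σZ ∈ G1 := pauli_G1 (by simp [pauliSet])
theorem G1_1 : 1 ∈ G1 := pauli_G1 (by simp [pauliSet])

theorem pauli_mul {p q} (hp : p ∈ pauliSet) (hq : q ∈ pauliSet) : p * q ∈ G1 := by
  simp only [pauliSet, Set.mem_insert_iff, Set.mem_singleton_iff] at hp hq
  rcases hp with rfl | rfl | rfl | rfl <;> rcases hq with rfl | rfl | rfl | rfl <;>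
    simp only [XX, YY, ZZ, XY, YX, YZ, ZY, ZX, XZ, one_mul, mul_one, neg_smul] <;>
    first
    | exact G1_1 | exact G1_X | exact G1_Y | exact G1_Z
    | exact G1_smul G1_X | exact G1_smul G1_Y | exact G1_smul G1_Z
    | exact G1_neg (G1_smul G1_X) | exact G1_neg (G1_smul G1_Y) | exact G1_neg (G1_smul G1_Z)

theorem G1_mul {M N} (hM : M ∈ G1) (hN : N ∈ G1) : M * N ∈ G1 := by
  obtain ⟨k, p, hp, rfl⟩ := hM
  obtain ⟨l, q, hq, rfl⟩ := hN
  rw [smul_mul_smul_comm, ← pow_add]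
  exact G1_pow (pauli_mul hp hq) _

theorem t_mem {M N} (hM : M ∈ G1) (hN : N ∈ G1) : kron M (toQ1 N) ∈ PauliGroup 2 := by
  obtain ⟨k, p, hp, rfl⟩ := hM
  obtain ⟨l, q, hq, rfl⟩ := hN
  rw [mem_pauli2]
  exact ⟨k + l, p, hp, q, hq, by rw [t_smul_left, t_smul_right, smul_smul, pow_add]⟩

theorem pauli2_t {P} (h : P ∈ PauliGroup 2) :
    ∃ M ∈ G1, ∃ N ∈ G1, P = kron M (toQ1 N) := by
  obtain ⟨k, p, hp, q, hq, rfl⟩ := (mem_pauli2 P).1 h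
  exact ⟨_, G1_pow (pauli_G1 hp) k, q, pauli_G1 hq, (t_smul_left ..).symm⟩

theorem pauli2_mul {P Q} (hP : P ∈ PauliGroup 2) (hQ : Q ∈ PauliGroup 2) :
    P * Q ∈ PauliGroup 2 := by
  obtain ⟨M, hM, N, hN, rfl⟩ := pauli2_t hP
  obtain ⟨M', hM', N', hN', rfl⟩ := pauli2_t hQ
  rw [t_mul]
  exact t_mem (G1_mul hM hM') (G1_mul hN hN')

theorem pauli_star {p} (hp : p ∈ pauliSet) : star p = p ∧ p * p = 1 := by
  simp only [pauliSet, Set.mem_insert_iff, Set.mem_singleton_iff] at hp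
  rcases hp with rfl | rfl | rfl | rfl <;>
    simp [starX, starY, starZ, XX, YY, ZZ]

theorem star_I_pow (k : ℕ) : star (Complex.I ^ k) * Complex.I ^ k = 1 := by
  rw [star_pow, ← mul_pow]; simp

theorem pauli2_unitary {P} (h : P ∈ PauliGroup 2) :
    star P ∈ PauliGroup 2 ∧ P ∈ unitary (QMat 2) := by
  obtain ⟨k, p, hp, q, hq, rfl⟩ := (mem_pauli2 P).1 h
  have e : star (Complex.I ^ k • kron p (toQ1 q)) = star (Complex.I ^ k) • kron p (toQ1 q) := by
    rw [star_smul, t_star, (pauli_star hp).1, (pauli_star hq).1]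
  constructor
  · rw [e, mem_pauli2]
    refine ⟨3 * k, p, hp, q, hq, ?_⟩
    congr 1
    rw [star_pow, pow_mul]
    congr 1
    simp [pow_succ]
  · rw [Unitary.mem_iff, e, smul_mul_smul_comm, smul_mul_smul_comm, t_mul, (pauli_star hp).2,
      (pauli_star hq).2, t_one, mul_comm (Complex.I ^ k), star_I_pow]
    simp

theorem mem_CH2 (U : QMat 2) : U ∈ CH 2 2 ↔
    U ∈ unitary (QMat 2) ∧ ∀ P ∈ PauliGroup 2, U * P * star U ∈ PauliGroup 2 := Iff.rfl

theorem mem_CH3 (U : QMat 2) : U ∈ CH 2 3 ↔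
    U ∈ unitary (QMat 2) ∧ ∀ P ∈ PauliGroup 2, U * P * star U ∈ CH 2 2 := Iff.rfl

theorem CH2_mul {U V} (hU : U ∈ CH 2 2) (hV : V ∈ CH 2 2) : U * V ∈ CH 2 2 := by
  rw [mem_CH2] at *
  refine ⟨mul_mem hU.1 hV.1, fun P hP => ?_⟩
  have := hU.2 _ (hV.2 P hP)
  simpa [mul_assoc] using this

theorem pauli_CH2 {P} (h : P ∈ PauliGroup 2) : P ∈ CH 2 2 :=
  ⟨(pauli2_unitary h).2, fun _ hQ => pauli2_mul (pauli2_mul h hQ) (pauli2_unitary h).1⟩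

/-- anything in a multiplicatively closed set containing generators -/
theorem gen {S : Set (Matrix (Fin 2) (Fin 2) ℂ)} (mul : ∀ x ∈ S, ∀ y ∈ S, x * y ∈ S)
    (hI : Complex.I • (1 : Matrix (Fin 2) (Fin 2) ℂ) ∈ S) {a c}
    (ha : a ∈ ({σX, σY, σZ} : Set (Matrix (Fin 2) (Fin 2) ℂ)))
    (hc : c ∈ ({σX, σY, σZ} : Set (Matrix (Fin 2) (Fin 2) ℂ)))
    (hne : a ≠ c) (haS : a ∈ S) (hcS : c ∈ S) {M} (hM : M ∈ G1) : M ∈ S := by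
  have smul : ∀ x ∈ S, Complex.I • x ∈ S := fun x hx => by simpa using mul _ hI x hx
  have pow : ∀ k : ℕ, ∀ x ∈ S, Complex.I ^ k • x ∈ S := by
    intro k
    induction k with
    | zero => intro x hx; simpa
    | succ k ih => intro x hx; rw [pow_succ', mul_smul]; exact smul _ (ih x hx)
  have h1 : (1 : Matrix (Fin 2) (Fin 2) ℂ) ∈ S := by
    have := pow 3 _ hI
    rw [smul_smul, ← pow_succ] at this
    simpa using this
  obtain ⟨k, p, hp, rfl⟩ := hM
  apply pow
  have h3 := smul _ (mul _ haS _ hcS)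
  have h4 := pow 3 _ (mul _ haS _ hcS)
  simp only [pauliSet, Set.mem_insert_iff, Set.mem_singleton_iff] at ha hc hp
  rcases ha with rfl | rfl | rfl <;> rcases hc with rfl | rfl | rfl <;>
    first
    | exact absurd rfl hne
    | (simp [XY, YX, YZ, ZY, ZX, XZ, smul_smul, pow_succ] at h3 h4
       rcases hp with rfl | rfl | rfl | rfl <;> assumption)

theorem conj_gen {T : Set (QMat 2)} (mul : ∀ x ∈ T, ∀ y ∈ T, x * y ∈ T)
    (hP : ∀ P ∈ PauliGroup 2, P ∈ T) {U : QMat 2} (hU : U ∈ unitary (QMat 2)) {a c}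
    (ha : a ∈ ({σX, σY, σZ} : Set (Matrix (Fin 2) (Fin 2) ℂ)))
    (hc : c ∈ ({σX, σY, σZ} : Set (Matrix (Fin 2) (Fin 2) ℂ)))
    (hne : a ≠ c)
    (hX : U * kron σX (toQ1 1) * star U ∈ T)
    (hZ : U * kron σZ (toQ1 1) * star U ∈ T)
    (hA : U * kron 1 (toQ1 a) * star U ∈ T)
    (hC : U * kron 1 (toQ1 c) * star U ∈ T) :
    ∀ P ∈ PauliGroup 2, U * P * star U ∈ T := by
  have cm : ∀ P Q : QMat 2, U * (P * Q) * star U = (U * P * star U) * (U * Q * star U) := by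
    intro P Q
    have := hU.1
    calc U * (P * Q) * star U = U * P * 1 * Q * star U := by simp [mul_assoc]
      _ = _ := by rw [← this]; simp only [mul_assoc]
  have hi : U * (Complex.I • (1 : QMat 2)) * star U ∈ T := by
    have : U * (Complex.I • (1 : QMat 2)) * star U = kron (Complex.I • 1) (toQ1 1) := by
      rw [t_smul_left, t_one]; simp [hU.2]
    rw [this]
    exact hP _ (t_mem (G1_smul G1_1) G1_1)
  have hxz : σX ≠ σZ := fun h => by
    have := congrFun (congrFun h 0) 0
    simp [σX, σZ] at this
  intro P hP
  obtain ⟨M, hM, N, hN, rfl⟩ := pauli2_t hP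
  have h1 : M ∈ {M | U * kron M (toQ1 1) * star U ∈ T} := by
    refine gen ?_ ?_ (a := σX) (c := σZ) (by simp) (by simp) hxz hX hZ hM
    · intro x hx y hy
      have := mul _ hx _ hy
      rw [← cm, t_mul] at this
      simpa using this
    · simpa [t_smul_left, t_one] using hi
  have h2 : N ∈ {N | U * kron 1 (toQ1 N) * star U ∈ T} := by
    refine gen ?_ ?_ ha hc hne hA hC hN
    · intro x hx y hy
      have := mul _ hx _ hy
      rw [← cm, t_mul] at this
      simpa using this
    · simpa [t_smul_right, t_one] using hi
  have := mul _ h1 _ h2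
  rw [← cm, t_mul] at this
  simpa using this

theorem t_add_right (M N N' : Matrix (Fin 2) (Fin 2) ℂ) :
    kron M (toQ1 (N + N')) = kron M (toQ1 N) + kron M (toQ1 N') := by
  ext f g; simp [kron, toQ1]; ring

theorem toQ1_one : toQ1 1 = (1 : QMat 1) := by
  ext f g
  simp only [toQ1, Matrix.one_apply]
  congr 1
  simp [funext_iff]

theorem D_conj (A B M N : Matrix (Fin 2) (Fin 2) ℂ) (hA : star A = A) (hB : star B = B) :
    dSum (toQ1 A) (toQ1 B) * kron M (toQ1 N) * star (dSum (toQ1 A) (toQ1 B)) =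
      kron !![M 0 0, 0; 0, 0] (toQ1 (A * N * A)) + kron !![0, M 0 1; 0, 0] (toQ1 (A * N * B)) +
      (kron !![0, 0; M 1 0, 0] (toQ1 (B * N * A)) +
        kron !![0, 0; 0, M 1 1] (toQ1 (B * N * B))) := by
  have s0 : star (!![1, 0; 0, 0] : Matrix (Fin 2) (Fin 2) ℂ) = !![1, 0; 0, 0] := by
    ext i j; fin_cases i <;> fin_cases j <;> simp [Matrix.star_apply]
  have s1 : star (!![0, 0; 0, 1] : Matrix (Fin 2) (Fin 2) ℂ) = !![0, 0; 0, 1] := by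
    ext i j; fin_cases i <;> fin_cases j <;> simp [Matrix.star_apply]
  have e : M = !![M 0 0, M 0 1; M 1 0, M 1 1] := Matrix.eta_fin_two M
  unfold dSum
  rw [star_add, t_star, t_star, hA, hB, s0, s1, add_mul, mul_add, add_mul, add_mul]
  simp only [t_mul]
  have e00 : !![1, 0; 0, 0] * M * !![1, 0; 0, 0] = !![M 0 0, 0; 0, 0] := by
    rw [e]; ext i j; fin_cases i <;> fin_cases j <;> simp
  have e01 : !![1, 0; 0, 0] * M * !![0, 0; 0, 1] = !![0, M 0 1; 0, 0] := by
    rw [e]; ext i j; fin_cases i <;> fin_cases j <;> simp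
  have e10 : !![0, 0; 0, 1] * M * !![1, 0; 0, 0] = !![0, 0; M 1 0, 0] := by
    rw [e]; ext i j; fin_cases i <;> fin_cases j <;> simp
  have e11 : !![0, 0; 0, 1] * M * !![0, 0; 0, 1] = !![0, 0; 0, M 1 1] := by
    rw [e]; ext i j; fin_cases i <;> fin_cases j <;> simp
  rw [e00, e01, e10, e11]
  abel

theorem D_unitary (A B : Matrix (Fin 2) (Fin 2) ℂ) (hA : star A = A) (hB : star B = B)
    (hA2 : A * A = 1) (hB2 : B * B = 1) : dSum (toQ1 A) (toQ1 B) ∈ unitary (QMat 2) := by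
  have h : dSum (toQ1 A) (toQ1 B) * star (dSum (toQ1 A) (toQ1 B)) = 1 := by
    have := D_conj A B 1 1 hA hB
    rw [t_one, mul_one] at this
    rw [this]
    simp only [mul_one, hA2, hB2]
    rw [← t_one]
    ext f g
    simp only [kron, Matrix.add_apply]
    generalize f 0 = x
    generalize g 0 = y
    fin_cases x <;> fin_cases y <;> simp
  exact Unitary.mem_iff.2 ⟨mul_eq_one_comm.1 h, h⟩

theorem core (a c V : Matrix (Fin 2) (Fin 2) ℂ)
    (ha : a ∈ ({σX, σY, σZ} : Set (Matrix (Fin 2) (Fin 2) ℂ)))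
    (hc : c ∈ ({σX, σY, σZ} : Set (Matrix (Fin 2) (Fin 2) ℂ)))
    (hne : a ≠ c) (b : Matrix (Fin 2) (Fin 2) ℂ) (hb : b ∈ G1)
    (sb : star b = b) (bb : b * b = 1) (ba : b * a = -(a * b)) (cb : b * c * b = -c)
    (ca : a * c * a = -c) (sV : star V = V) (VV : V * V = 1)
    (Va : V * a * V = b) (Vc : V * c * V = -c) :
    dSum (1 : QMat 1) (toQ1 V) ∈ CH 2 3 := by
  have hap : a ∈ pauliSet := by unfold pauliSet; exact Set.mem_insert_of_mem _ ha
  have hcp : c ∈ pauliSet := by unfold pauliSet; exact Set.mem_insert_of_mem _ hc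
  obtain ⟨sa, aa⟩ := pauli_star hap
  have haG := pauli_G1 hap
  have hcG := pauli_G1 hcp
  have s1 : star (1 : Matrix (Fin 2) (Fin 2) ℂ) = 1 := star_one _
  rw [← toQ1_one]
  have hU := D_unitary 1 V s1 sV (one_mul 1) VV
  refine (mem_CH3 _).2 ⟨hU, conj_gen (fun x hx y hy => CH2_mul hx hy) (fun P hP => pauli_CH2 hP)
    hU ha hc hne ?_ ?_ ?_ ?_⟩
  · -- X ⊗ 1 ↦ X ⊗ V
    have e : dSum (toQ1 1) (toQ1 V) * kron σX (toQ1 1) * star (dSum (toQ1 1) (toQ1 V)) =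
        kron σX (toQ1 V) := by
      rw [D_conj _ _ _ _ s1 sV]
      simp only [mul_one, one_mul]
      ext f g
      simp only [kron, Matrix.add_apply]
      generalize f 0 = x
      generalize g 0 = y
      fin_cases x <;> fin_cases y <;> simp [σX]
    rw [e]
    have se : star (kron σX (toQ1 V)) = kron σX (toQ1 V) := by rw [t_star, starX, sV]
    have hu : kron σX (toQ1 V) ∈ unitary (QMat 2) := by
      rw [Unitary.mem_iff, se, t_mul, XX, VV, t_one]; simp
    refine (mem_CH2 _).2 ⟨hu, conj_gen (fun x hx y hy => pauli2_mul hx hy) (fun P hP => hP)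
      hu ha hc hne ?_ ?_ ?_ ?_⟩ <;> rw [se, t_mul, t_mul]
    · simp only [mul_one, VV]
      exact t_mem (G1_mul (G1_mul G1_X G1_X) G1_X) G1_1
    · simp only [mul_one, VV]
      exact t_mem (G1_mul (G1_mul G1_X G1_Z) G1_X) G1_1
    · rw [Va]
      exact t_mem (G1_mul (G1_mul G1_X G1_1) G1_X) hb
    · rw [Vc]
      exact t_mem (G1_mul (G1_mul G1_X G1_1) G1_X) (G1_neg hcG)
  · -- Z ⊗ 1 ↦ Z ⊗ 1
    have e : dSum (toQ1 1) (toQ1 V) * kron σZ (toQ1 1) * star (dSum (toQ1 1) (toQ1 V)) =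
        kron σZ (toQ1 1) := by
      rw [D_conj _ _ _ _ s1 sV]
      simp only [mul_one, VV]
      ext f g
      simp only [kron, Matrix.add_apply]
      generalize f 0 = x
      generalize g 0 = y
      fin_cases x <;> fin_cases y <;> simp [σZ]
    rw [e]
    exact pauli_CH2 (t_mem G1_Z G1_1)
  · -- 1 ⊗ a ↦ a ⊕ b
    have e : dSum (toQ1 1) (toQ1 V) * kron 1 (toQ1 a) * star (dSum (toQ1 1) (toQ1 V)) =
        dSum (toQ1 a) (toQ1 b) := by
      rw [D_conj _ _ _ _ s1 sV]
      simp only [mul_one, one_mul, Va]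
      ext f g
      simp only [dSum, kron, Matrix.add_apply]
      generalize f 0 = x
      generalize g 0 = y
      fin_cases x <;> fin_cases y <;> simp
    rw [e]
    have hu := D_unitary a b sa sb aa bb
    refine (mem_CH2 _).2 ⟨hu, conj_gen (fun x hx y hy => pauli2_mul hx hy) (fun P hP => hP)
      hu ha hc hne ?_ ?_ ?_ ?_⟩ <;> rw [D_conj _ _ _ _ sa sb]
    · simp only [mul_one, ba]
      convert t_mem (G1_mul G1_Z G1_X) (G1_mul haG hb) using 1
      ext f g
      simp only [kron, Matrix.add_apply]
      generalize f 0 = x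
      generalize g 0 = y
      fin_cases x <;> fin_cases y <;> simp [σX, σZ, toQ1]
    · simp only [mul_one, aa, bb]
      convert t_mem G1_Z G1_1 using 1
      ext f g
      simp only [kron, Matrix.add_apply]
      generalize f 0 = x
      generalize g 0 = y
      fin_cases x <;> fin_cases y <;> simp [σZ, toQ1]
    · have bab : b * a * b = -a := by rw [ba, neg_mul, mul_assoc, bb, mul_one]
      have aba : b * a * a = b := by rw [mul_assoc, aa, mul_one]
      rw [bab, aba, aa, one_mul, one_mul]
      convert t_mem G1_Z haG using 1
      ext f g
      simp only [kron, Matrix.add_apply]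
      generalize f 0 = x
      generalize g 0 = y
      fin_cases x <;> fin_cases y <;> simp [σZ, toQ1]
    · rw [ca, cb]
      convert t_mem G1_1 (G1_neg hcG) using 1
      ext f g
      simp only [kron, Matrix.add_apply]
      generalize f 0 = x
      generalize g 0 = y
      fin_cases x <;> fin_cases y <;> simp [toQ1]
  · -- 1 ⊗ c ↦ Z ⊗ c
    have e : dSum (toQ1 1) (toQ1 V) * kron 1 (toQ1 c) * star (dSum (toQ1 1) (toQ1 V)) =
        kron σZ (toQ1 c) := by
      rw [D_conj _ _ _ _ s1 sV]
      simp only [mul_one, one_mul, Vc]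
      ext f g
      simp only [kron, Matrix.add_apply]
      generalize f 0 = x
      generalize g 0 = y
      fin_cases x <;> fin_cases y <;> simp [σZ, toQ1]
    rw [e]
    exact pauli_CH2 (t_mem G1_Z hcG)

theorem anticomm {a c : Matrix (Fin 2) (Fin 2) ℂ}
    (ha : a ∈ ({σX, σY, σZ} : Set (Matrix (Fin 2) (Fin 2) ℂ)))
    (hc : c ∈ ({σX, σY, σZ} : Set (Matrix (Fin 2) (Fin 2) ℂ)))
    (hne : a ≠ c) : c * a = -(a * c) := by
  simp only [Set.mem_insert_iff, Set.mem_singleton_iff] at ha hc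
  rcases ha with rfl | rfl | rfl <;> rcases hc with rfl | rfl | rfl <;>
    first
    | exact absurd rfl hne
    | simp [XY, YX, YZ, ZY, ZX, XZ]

/-- Adding a control to any Hadamard-like gate `V = σ₁ · exp(i(π/4)σ₂)`
(with `σ₁, σ₂ ∈ {X, Y, Z}`, `σ₁ ≠ σ₂`) gives a gate `C(V) = I ⊕ V` in the third level of
the Clifford Hierarchy on 2 qubits. -/
theorem stmt15 (σ₁ σ₂ : Matrix (Fin 2) (Fin 2) ℂ)
    (h₁ : σ₁ ∈ ({σX, σY, σZ} : Set (Matrix (Fin 2) (Fin 2) ℂ)))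
    (h₂ : σ₂ ∈ ({σX, σY, σZ} : Set (Matrix (Fin 2) (Fin 2) ℂ)))
    (hne : σ₁ ≠ σ₂) :
    dSum (1 : QMat 1) (toQ1 (σ₁ * pexp σ₂)) ∈ CH 2 3 := by
  have hap : σ₁ ∈ pauliSet := by unfold pauliSet; exact Set.mem_insert_of_mem _ h₁
  have hcp : σ₂ ∈ pauliSet := by unfold pauliSet; exact Set.mem_insert_of_mem _ h₂
  obtain ⟨sa, aa⟩ := pauli_star hap
  obtain ⟨sc, cc⟩ := pauli_star hcp
  have ac := anticomm h₁ h₂ hne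
  obtain ⟨b, hbdef⟩ : ∃ b, b = Complex.I • (σ₁ * σ₂) := ⟨_, rfl⟩
  have hb : b ∈ G1 := hbdef ▸ G1_smul (G1_mul (pauli_G1 hap) (pauli_G1 hcp))
  have aac : σ₁ * (σ₁ * σ₂) = σ₂ := by rw [← mul_assoc, aa, one_mul]
  have aca : σ₁ * σ₂ * σ₁ = -σ₂ := by rw [mul_assoc, ac, mul_neg, aac]
  have sb : star b = b := by
    rw [hbdef, star_smul, star_mul, sa, sc, ac]; simp
  have bb : b * b = 1 := by
    rw [hbdef, smul_mul_smul_comm, ← mul_assoc, aca, neg_mul, cc]; simp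
  have ba : b * σ₁ = -(σ₁ * b) := by
    rw [hbdef, smul_mul_assoc, mul_smul_comm, aca, aac, smul_neg]
  have bc : b * σ₂ = -(σ₂ * b) := by
    rw [hbdef, smul_mul_assoc, mul_smul_comm, ← mul_assoc, ac, neg_mul, smul_neg, neg_neg]
  have cb : b * σ₂ * b = -σ₂ := by
    rw [bc, neg_mul, mul_assoc, bb, mul_one]
  obtain ⟨s, hs⟩ : ∃ s : ℂ, s = ((√2 / 2 : ℝ) : ℂ) := ⟨_, rfl⟩
  have ss : s * s = 1 / 2 := by
    rw [hs, ← Complex.ofReal_mul]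
    have : (√2 / 2 : ℝ) * (√2 / 2) = 1 / 2 := by
      have := Real.mul_self_sqrt (show (0 : ℝ) ≤ 2 by norm_num)
      nlinarith
    rw [this]; norm_num
  have sts : star s = s := by rw [hs]; exact Complex.conj_ofReal _
  have hV : σ₁ * pexp σ₂ = s • (σ₁ + b) := by
    rw [pexp, Real.cos_pi_div_four, Real.sin_pi_div_four, ← hs, hbdef, mul_add, mul_smul_comm,
      mul_smul_comm, mul_one, smul_add, smul_smul, mul_comm s]
  have key : (σ₁ + b) * (σ₁ + b) = (2 : ℂ) • 1 := by
    rw [add_mul, mul_add, mul_add, aa, bb, ba, two_smul]; abel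
  have baa : b * σ₁ * σ₁ = b := by rw [mul_assoc, aa, mul_one]
  have bab : b * σ₁ * b = -σ₁ := by rw [ba, neg_mul, mul_assoc, bb, mul_one]
  have keya : (σ₁ + b) * σ₁ * (σ₁ + b) = (2 : ℂ) • b := by
    rw [add_mul, mul_add, add_mul, add_mul, aa, one_mul, one_mul, baa, bab, two_smul]; abel
  have keyc : (σ₁ + b) * σ₂ * (σ₁ + b) = (2 : ℂ) • (-σ₂) := by
    have : (σ₁ + b) * σ₂ = -(σ₂ * (σ₁ + b)) := by
      rw [add_mul, mul_add, bc, ac]; abel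
    rw [this, neg_mul, mul_assoc, key, mul_smul_comm, mul_one, smul_neg]
  have half : s * s * 2 = 1 := by rw [ss]; norm_num
  rw [hV]
  refine core σ₁ σ₂ _ h₁ h₂ hne b hb sb bb ba cb aca ?_ ?_ ?_ ?_
  · rw [star_smul, star_add, sa, sb, sts]
  · rw [smul_mul_smul_comm, key, smul_smul, half, one_smul]
  · rw [smul_mul_assoc, smul_mul_smul_comm, keya, smul_smul, half, one_smul]
  · rw [smul_mul_assoc, smul_mul_smul_comm, keyc, smul_smul, half, one_smul]
end
end
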